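/- arXiv:0810.2361 — 6 statements merged into one kernel-verified Lean document; each statement's English description precedes it below -/
import Mathlib

section
/- Let C be a category that is preadditive, ℂ-linear, and has finite biproducts (in particular a zero object). Suppose there exist k : ℕ and objects X : Fin k → C such that: (i) for each i, the hom-space (X i ⟶ X i) is a one-dimensional ℂ-vector space; (ii) for i ≠ j, the hom-space (X i ⟶ X j) is the zero vector space; and (iii) every object of C is isomorphic to a finite biproduct of copies of the objects X i. Then C is equivalent as a category to the product category Fin k → FGModuleCat ℂ. -/
open CategoryTheory CategoryTheory.Limits

section Helpers

universe v w u

/-- Every finite-dimensional vector space is isomorphic to one lifted from a given universe. -/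
instance FGModuleCat.essSurj_ulift (K : Type) [Field K] :
    (FGModuleCat.ulift.{v, w, 0} K).EssSurj where
  mem_essImage V := by
    refine ⟨FGModuleCat.of K (ULift.{v} (Fin (Module.finrank K V) → K)),
      ⟨LinearEquiv.toFGModuleCatIso ?_⟩⟩
    exact LinearEquiv.ofFinrankEq _ _ (by
      rw [LinearEquiv.finrank_eq ULift.moduleEquiv, LinearEquiv.finrank_eq ULift.moduleEquiv]
      simp)

/-- The categories of finite-dimensional vector spaces in two universes are equivalent. -/
noncomputable def FGModuleCat.universeEquivalence (K : Type) [Field K] :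
    FGModuleCat.{v} K ≌ FGModuleCat.{w} K :=
  haveI : (FGModuleCat.ulift.{v, w, 0} K).IsEquivalence := {}
  haveI : (FGModuleCat.ulift.{w, v, 0} K).IsEquivalence := {}
  (FGModuleCat.ulift.{v, w, 0} K).asEquivalence.trans
    (FGModuleCat.ulift.{w, v, 0} K).asEquivalence.symm

variable {C : Type u} [Category.{v} C] [Preadditive C] [Linear ℂ C]

/-- A morphism into a biproduct, as a family of morphisms, linearly. -/
noncomputable def homBiproductLinearEquiv {ι : Type} [Fintype ι] (A : C) (B : ι → C)
    [HasBiproduct B] : (A ⟶ ⨁ B) ≃ₗ[ℂ] (∀ p, A ⟶ B p) where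
  toFun f p := f ≫ biproduct.π B p
  invFun g := biproduct.lift g
  map_add' f g := by ext; simp
  map_smul' c f := by ext; simp
  left_inv f := by ext; simp
  right_inv g := by ext; simp

variable {k : ℕ} {X : Fin k → C}

theorem sum_sigma_fin_ite (n : Fin k → ℕ) (i : Fin k) :
    (∑ p : Σ j : Fin k, Fin (n j), if p.1 = i then 1 else 0) = n i := by
  rw [Fintype.sum_sigma]
  change (∑ j : Fin k, ∑ _a : Fin (n j), if j = i then 1 else 0) = n i
  simp

theorem finrank_hom_eq_ite (hsimple : ∀ i, Module.finrank ℂ (X i ⟶ X i) = 1)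
    (hdistinct : ∀ i j, i ≠ j → ∀ f : X i ⟶ X j, f = 0) (i j : Fin k) :
    Module.finrank ℂ (X i ⟶ X j) = if j = i then 1 else 0 := by
  split_ifs with h
  · subst h; exact hsimple j
  · have : Subsingleton (X i ⟶ X j) :=
      subsingleton_of_forall_eq 0 (hdistinct i j (Ne.symm h))
    exact Module.finrank_zero_of_subsingleton

theorem finite_hom (hsimple : ∀ i, Module.finrank ℂ (X i ⟶ X i) = 1)
    (hdistinct : ∀ i j, i ≠ j → ∀ f : X i ⟶ X j, f = 0) (i j : Fin k) :
    Module.Finite ℂ (X i ⟶ X j) := by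
  by_cases h : i = j
  · subst h; exact Module.finite_of_finrank_eq_succ (hsimple i)
  · have : Subsingleton (X i ⟶ X j) := subsingleton_of_forall_eq 0 (hdistinct i j h)
    infer_instance

/-- Families of linear maps `(X i ⟶ Y) → (X i ⟶ Z)` commute with precomposition by any morphism
between the simple objects. -/
theorem map_comp_of_simple (hsimple : ∀ i, Module.finrank ℂ (X i ⟶ X i) = 1)
    (hdistinct : ∀ i j, i ≠ j → ∀ f : X i ⟶ X j, f = 0) {Y Z : C}
    (φ : ∀ i, (X i ⟶ Y) →ₗ[ℂ] (X i ⟶ Z)) {i j : Fin k} (c : X i ⟶ X j) (h : X j ⟶ Y) :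
    φ i (c ≫ h) = c ≫ φ j h := by
  by_cases hij : i = j
  · subst hij
    have hid : 𝟙 (X i) ≠ 0 := by
      intro h0
      have : Subsingleton (X i ⟶ X i) := subsingleton_of_forall_eq 0 fun f => by
        rw [← Category.comp_id f, h0, comp_zero]
      have := hsimple i
      rw [Module.finrank_zero_of_subsingleton] at this
      exact zero_ne_one this
    obtain ⟨a, rfl⟩ := exists_smul_eq_of_finrank_eq_one (hsimple i) hid c
    simp
  · rw [hdistinct i j hij c]
    simp

variable [HasFiniteBiproducts C]

theorem finite_hom_of_iso (hsimple : ∀ i, Module.finrank ℂ (X i ⟶ X i) = 1)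
    (hdistinct : ∀ i j, i ≠ j → ∀ f : X i ⟶ X j, f = 0)
    (hgen : ∀ Y : C, ∃ n : Fin k → ℕ,
      Nonempty (Y ≅ ⨁ fun p : Σ i : Fin k, Fin (n i) => X p.1)) (i : Fin k) (Y : C) :
    Module.Finite ℂ (X i ⟶ Y) := by
  obtain ⟨n, ⟨e⟩⟩ := hgen Y
  have := finite_hom hsimple hdistinct
  exact Module.Finite.equiv ((Linear.homCongr ℂ (Iso.refl (X i)) e).trans
    (homBiproductLinearEquiv _ _)).symm

/-- The functor `Y ↦ (i ↦ (X i ⟶ Y))`. -/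
noncomputable def multiplicityFunctor (hfin : ∀ i Y, Module.Finite ℂ (X i ⟶ Y)) :
    C ⥤ (Fin k → FGModuleCat.{v} ℂ) :=
  Functor.pi' fun i => (ModuleCat.isFG ℂ).lift
    ((linearCoyoneda ℂ C).obj (Opposite.op (X i))) (hfin i)

theorem multiplicityFunctor_faithful
    (hgen : ∀ Y : C, ∃ n : Fin k → ℕ,
      Nonempty (Y ≅ ⨁ fun p : Σ i : Fin k, Fin (n i) => X p.1))
    (hfin : ∀ i Y, Module.Finite ℂ (X i ⟶ Y)) :
    (multiplicityFunctor hfin).Faithful where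
  map_injective {Y Z} f g hfg := by
    obtain ⟨n, ⟨e⟩⟩ := hgen Y
    rw [← cancel_epi e.inv]
    refine biproduct.hom_ext' _ _ fun p => ?_
    have h : (biproduct.ι (fun p : Σ i : Fin k, Fin (n i) => X p.1) p ≫ e.inv) ≫ f =
        (biproduct.ι (fun p : Σ i : Fin k, Fin (n i) => X p.1) p ≫ e.inv) ≫ g :=
      LinearMap.congr_fun (congrArg (fun m => m.hom.hom) (congrFun hfg p.1)) _
    simpa only [Category.assoc] using h

theorem multiplicityFunctor_full (hsimple : ∀ i, Module.finrank ℂ (X i ⟶ X i) = 1)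
    (hdistinct : ∀ i j, i ≠ j → ∀ f : X i ⟶ X j, f = 0)
    (hgen : ∀ Y : C, ∃ n : Fin k → ℕ,
      Nonempty (Y ≅ ⨁ fun p : Σ i : Fin k, Fin (n i) => X p.1))
    (hfin : ∀ i Y, Module.Finite ℂ (X i ⟶ Y)) :
    (multiplicityFunctor hfin).Full where
  map_surjective {Y Z} ψ := by
    obtain ⟨n, ⟨e⟩⟩ := hgen Y
    let φ : ∀ i, (X i ⟶ Y) →ₗ[ℂ] (X i ⟶ Z) := fun i => (ψ i).hom.hom
    let B := fun p : Σ i : Fin k, Fin (n i) => X p.1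
    change Y ≅ ⨁ B at e
    refine ⟨e.hom ≫ biproduct.desc fun p => φ p.1 (biproduct.ι B p ≫ e.inv), ?_⟩
    funext i
    apply FGModuleCat.hom_ext
    refine LinearMap.ext fun (g : X i ⟶ Y) => ?_
    change g ≫ e.hom ≫ biproduct.desc _ = φ i g
    have hg : g = ∑ p, (g ≫ e.hom ≫ biproduct.π B p) ≫ biproduct.ι B p ≫ e.inv := by
      calc g = g ≫ e.hom ≫ (∑ p, biproduct.π B p ≫ biproduct.ι B p) ≫ e.inv := by
            rw [biproduct.total]; simp
        _ = _ := by simp only [Preadditive.sum_comp, Preadditive.comp_sum, Category.assoc]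
    conv_rhs => rw [hg, map_sum]
    rw [biproduct.desc_eq, Preadditive.comp_sum, Preadditive.comp_sum]
    refine Finset.sum_congr rfl fun p _ => ?_
    rw [map_comp_of_simple hsimple hdistinct φ]
    simp only [Category.assoc, B]

theorem multiplicityFunctor_essSurj (hsimple : ∀ i, Module.finrank ℂ (X i ⟶ X i) = 1)
    (hdistinct : ∀ i j, i ≠ j → ∀ f : X i ⟶ X j, f = 0)
    (hfin : ∀ i Y, Module.Finite ℂ (X i ⟶ Y)) :
    (multiplicityFunctor hfin).EssSurj where
  mem_essImage V := by
    let n : Fin k → ℕ := fun i => Module.finrank ℂ (V i)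
    let B := fun p : Σ i : Fin k, Fin (n i) => X p.1
    refine ⟨⨁ B, ⟨Pi.isoMk fun i => ?_⟩⟩
    have hrank : Module.finrank ℂ (X i ⟶ ⨁ B) = Module.finrank ℂ (V i) := by
      have := finite_hom hsimple hdistinct
      rw [(homBiproductLinearEquiv (X i) B).finrank_eq, Module.finrank_pi_fintype]
      simp only [B, finrank_hom_eq_ite hsimple hdistinct]
      exact sum_sigma_fin_ite n i
    haveI := hfin i (⨁ B)
    exact (LinearEquiv.ofFinrankEq (X i ⟶ ⨁ B) (V i) hrank).toFGModuleCatIso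

end Helpers

/-- **Classification of Kapranov–Voevodsky 2-vector spaces.**
If `C` is a ℂ-linear additive category which is semisimple with finitely many simple
objects — i.e. there are objects `X 0, …, X (k-1)` with one-dimensional endomorphism
spaces and no nonzero morphisms between distinct ones, such that every object of `C`
is a finite biproduct of copies of the `X i` — then `C` is equivalent to `Vect^k`,
modeled as the product category `Fin k → FGModuleCat ℂ`. -/
theorem kv_two_vector_space_classification
    (C : Type*) [Category C] [Preadditive C] [Linear ℂ C] [HasFiniteBiproducts C]
    (k : ℕ) (X : Fin k → C)
    (hsimple : ∀ i, Module.finrank ℂ (X i ⟶ X i) = 1)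
    (hdistinct : ∀ i j, i ≠ j → ∀ f : X i ⟶ X j, f = 0)
    (hgen : ∀ Y : C, ∃ n : Fin k → ℕ,
      Nonempty (Y ≅ ⨁ fun p : Σ i : Fin k, Fin (n i) => X p.1)) :
    Nonempty (C ≌ (Fin k → FGModuleCat ℂ)) := by
  have hfin := finite_hom_of_iso hsimple hdistinct hgen
  have := multiplicityFunctor_faithful hgen hfin
  have := multiplicityFunctor_full hsimple hdistinct hgen hfin
  have := multiplicityFunctor_essSurj hsimple hdistinct hfin
  have : (multiplicityFunctor hfin).IsEquivalence := {}
  exact ⟨(multiplicityFunctor hfin).asEquivalence.trans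
    (Equivalence.pi fun _ => FGModuleCat.universeEquivalence ℂ)⟩
end

section
/- Every additive ℂ-linear functor F : (Fin n → FGModuleCat ℂ) ⥤ (Fin m → FGModuleCat ℂ) admits an ambidextrous adjoint: there exists a functor G : (Fin m → FGModuleCat ℂ) ⥤ (Fin n → FGModuleCat ℂ) such that G is a left adjoint of F (there is an adjunction G ⊣ F) and G is also a right adjoint of F (there is an adjunction F ⊣ G). -/
open CategoryTheory CategoryTheory.Limits

instance piPreadditive {I : Type*} (C : I → Type*) [∀ i, Category (C i)]
    [∀ i, Preadditive (C i)] : Preadditive (∀ i, C i) where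
  homGroup P Q := inferInstanceAs (AddCommGroup (∀ i, P i ⟶ Q i))
  add_comp := by intros; funext i; exact Preadditive.add_comp _ _ _ _ _ _
  comp_add := by intros; funext i; exact Preadditive.comp_add _ _ _ _ _ _

instance piLinear {I : Type*} (C : I → Type*) [∀ i, Category (C i)]
    [∀ i, Preadditive (C i)] [∀ i, Linear ℂ (C i)] : Linear ℂ (∀ i, C i) where
  homModule P Q := inferInstanceAs (Module ℂ (∀ i, P i ⟶ Q i))
  smul_comp := by intros; funext i; exact Linear.smul_comp _ _ _ _ _ _
  comp_smul := by intros; funext i; exact Linear.comp_smul _ _ _ _ _ _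

universe v

section PiHom

variable {I : Type*} [DecidableEq I] {C : I → Type*} [∀ i, Category (C i)]
  [∀ i, Preadditive (C i)] [∀ i, Linear ℂ (C i)]

/-- The morphism of families which is `f` at the index `i` and zero elsewhere, depending
linearly on `f`. -/
def piSingleHom {X Y : ∀ i, C i} (i : I) : (X i ⟶ Y i) →ₗ[ℂ] (X ⟶ Y) :=
  LinearMap.single ℂ (fun i => X i ⟶ Y i) i

@[simp]
lemma piSingleHom_same {X Y : ∀ i, C i} (i : I) (f : X i ⟶ Y i) :
    piSingleHom (X := X) (Y := Y) i f i = f :=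
  Pi.single_eq_same (M := fun i => X i ⟶ Y i) i f

lemma piSingleHom_ne {X Y : ∀ i, C i} {i j : I} (h : j ≠ i) (f : X i ⟶ Y i) :
    piSingleHom (X := X) (Y := Y) i f j = 0 :=
  Pi.single_eq_of_ne (M := fun i => X i ⟶ Y i) h f

lemma piSingleHom_comp {X Y Z : ∀ i, C i} (i : I) (f : X i ⟶ Y i) (g : Y ⟶ Z) :
    piSingleHom (X := X) i f ≫ g = piSingleHom i (f ≫ g i) := by
  funext j
  by_cases h : j = i
  · subst h; simp [Pi.comp_apply]
  · simp [Pi.comp_apply, piSingleHom_ne h]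

lemma piSingleHom_comp_piSingleHom_of_ne {X Y Z : ∀ i, C i} {i j : I} (h : i ≠ j)
    (f : X i ⟶ Y i) (g : Y j ⟶ Z j) :
    piSingleHom (X := X) (Y := Y) i f ≫ piSingleHom (X := Y) (Y := Z) j g = 0 := by
  rw [piSingleHom_comp, piSingleHom_ne h, comp_zero, map_zero]

lemma sum_piSingleHom [Fintype I] {X Y : ∀ i, C i} (f : X ⟶ Y) :
    ∑ i, piSingleHom (X := X) (Y := Y) i (f i) = f :=
  Finset.univ_sum_single (M := fun i => X i ⟶ Y i) f

end PiHom

section Trace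

/-- A family of cyclic traces on the endomorphisms of a ℂ-linear category such that
composition followed by the trace identifies `Y ⟶ X` with the dual of `X ⟶ Y`. -/
structure PerfectTrace (C : Type*) [Category C] [Preadditive C] [Linear ℂ C] where
  tr (X : C) : (X ⟶ X) →ₗ[ℂ] ℂ
  tr_comm {X Y : C} (f : X ⟶ Y) (g : Y ⟶ X) : tr X (f ≫ g) = tr Y (g ≫ f)
  existsUnique {X Y : C} (φ : (X ⟶ Y) →ₗ[ℂ] ℂ) : ∃! g : Y ⟶ X, ∀ f, tr X (f ≫ g) = φ f

namespace PerfectTrace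

variable {C D : Type*} [Category C] [Preadditive C] [Linear ℂ C]
  [Category D] [Preadditive D] [Linear ℂ D]

lemma ext (T : PerfectTrace C) {X Y : C} {g h : Y ⟶ X}
    (w : ∀ f : X ⟶ Y, T.tr X (f ≫ g) = T.tr X (f ≫ h)) : g = h :=
  (T.existsUnique ((T.tr X).comp (Linear.rightComp ℂ X h))).unique w fun _ => rfl

/-- The morphism representing a linear form on a hom-space through the trace. -/
noncomputable def repr (T : PerfectTrace C) {X Y : C} (φ : (X ⟶ Y) →ₗ[ℂ] ℂ) : Y ⟶ X :=
  (T.existsUnique φ).choose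

@[simp]
lemma tr_comp_repr (T : PerfectTrace C) {X Y : C} (φ : (X ⟶ Y) →ₗ[ℂ] ℂ) (f : X ⟶ Y) :
    T.tr X (f ≫ T.repr φ) = φ f :=
  (T.existsUnique φ).choose_spec.1 f

/-- Between categories with perfect traces, a right adjoint of a linear functor is also a
left adjoint. -/
theorem nonempty_adjunction_of_adjunction (S : PerfectTrace C) (T : PerfectTrace D)
    {F : C ⥤ D} {G : D ⥤ C} [F.Additive] [F.Linear ℂ] (adj : F ⊣ G) : Nonempty (G ⊣ F) := by
  let e (X : C) (Y : D) : (F.obj X ⟶ Y) ≃ₗ[ℂ] (X ⟶ G.obj Y) :=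
    ((adj.homEquiv X Y).symm.toLinearEquiv
      { map_add := fun f g => by simp [Adjunction.homEquiv_counit]
        map_smul := fun c f => by simp [Adjunction.homEquiv_counit, Functor.map_smul] }).symm
  have e_left {X X' : C} {Y : D} (u : X' ⟶ X) (k : F.obj X ⟶ Y) :
      e X' Y (F.map u ≫ k) = u ≫ e X Y k := adj.homEquiv_naturality_left u k
  have e_right {X : C} {Y Y' : D} (k : F.obj X ⟶ Y) (v : Y ⟶ Y') :
      e X Y' (k ≫ v) = e X Y k ≫ G.map v := adj.homEquiv_naturality_right k v
  let toFun (Y : D) (X : C) (f : G.obj Y ⟶ X) : Y ⟶ F.obj X :=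
    T.repr ((S.tr X).comp ((Linear.rightComp ℂ X f).comp (e X Y).toLinearMap))
  let invFun (Y : D) (X : C) (h : Y ⟶ F.obj X) : G.obj Y ⟶ X :=
    S.repr ((T.tr (F.obj X)).comp
      ((Linear.rightComp ℂ (F.obj X) h).comp (e X Y).symm.toLinearMap))
  have tr_toFun (Y : D) (X : C) (f : G.obj Y ⟶ X) (k : F.obj X ⟶ Y) :
      T.tr _ (k ≫ toFun Y X f) = S.tr _ (e X Y k ≫ f) := by simp [toFun]
  have tr_invFun (Y : D) (X : C) (h : Y ⟶ F.obj X) (k : X ⟶ G.obj Y) :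
      S.tr _ (k ≫ invFun Y X h) = T.tr _ ((e X Y).symm k ≫ h) := by simp [invFun]
  refine ⟨Adjunction.mkOfHomEquiv
    { homEquiv := fun Y X =>
        { toFun := toFun Y X
          invFun := invFun Y X
          left_inv := fun f => S.ext fun k => by simp [tr_invFun, tr_toFun]
          right_inv := fun h => T.ext fun k => by simp [tr_invFun, tr_toFun] }
      homEquiv_naturality_left_symm := fun {Y' Y X} v h => S.ext fun k => ?_
      homEquiv_naturality_right := fun {Y X X'} f u => T.ext fun k => ?_ }⟩
  · obtain ⟨k, rfl⟩ := (e X Y').surjective k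
    change S.tr _ (_ ≫ invFun Y' X (v ≫ h)) = S.tr _ (_ ≫ G.map v ≫ invFun Y X h)
    rw [tr_invFun, ← Category.assoc _ (G.map v), ← e_right, tr_invFun]
    simp
  · change T.tr _ (_ ≫ toFun Y X' (f ≫ u)) = T.tr _ (_ ≫ toFun Y X f ≫ F.map u)
    rw [tr_toFun, ← Category.assoc k, T.tr_comm, ← Category.assoc (F.map u), tr_toFun, e_left,
      Category.assoc, S.tr_comm u, Category.assoc]

/-- The trace on a finite product of categories given by the sum of the componentwise traces. -/
noncomputable def pi {I : Type*} [Fintype I] [DecidableEq I] {C : I → Type*}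
    [∀ i, Category (C i)] [∀ i, Preadditive (C i)] [∀ i, Linear ℂ (C i)]
    (T : ∀ i, PerfectTrace (C i)) : PerfectTrace (∀ i, C i) where
  tr X := ∑ i, ((T i).tr (X i)).comp (LinearMap.proj (φ := fun i => X i ⟶ X i) i)
  tr_comm {X Y} f g := by
    simp only [LinearMap.sum_apply]
    exact Finset.sum_congr rfl fun i _ => (T i).tr_comm (f i) (g i)
  existsUnique {X Y} φ := by
    have key (g : Y ⟶ X) (f : X ⟶ Y) :
        (∑ i, ((T i).tr (X i)).comp (LinearMap.proj (φ := fun i => X i ⟶ X i) i)) (f ≫ g) =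
          ∑ i, (T i).tr (X i) (f i ≫ g i) := by
      simp only [LinearMap.sum_apply]; rfl
    simp only [key]
    refine ⟨fun i => (T i).repr (φ.comp (piSingleHom i)), fun f => ?_, fun g hg => ?_⟩
    · simp only [tr_comp_repr, LinearMap.comp_apply, ← map_sum, sum_piSingleHom]
    · funext i
      refine (T i).ext fun f => ?_
      rw [tr_comp_repr, LinearMap.comp_apply, ← hg, Finset.sum_eq_single i, piSingleHom_same]
      · intro j _ hj
        simp [piSingleHom_ne hj]
      · simp

end PerfectTrace

lemma LinearMap.eq_zero_of_trace_comp_eq_zero {K V W : Type*} [Field K] [AddCommGroup V]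
    [Module K V] [Module.Finite K V] [AddCommGroup W] [Module K W] {g : W →ₗ[K] V}
    (h : ∀ f : V →ₗ[K] W, LinearMap.trace K V (g ∘ₗ f) = 0) : g = 0 := by
  ext w
  refine (Module.forall_dual_apply_eq_zero_iff K (g w)).1 fun δ => ?_
  have := h (δ.smulRight w)
  rwa [show g ∘ₗ δ.smulRight w = δ.smulRight (g w) by ext; simp, trace_smulRight] at this

/-- The trace of endomorphisms of finite-dimensional vector spaces. -/
noncomputable def fgModuleCatPerfectTrace : PerfectTrace (FGModuleCat ℂ) where
  tr X := (LinearMap.trace ℂ X).comp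
    ((ModuleCat.homLinearEquiv (S := ℂ)).toLinearMap.comp
      (InducedCategory.homLinearEquiv (R := ℂ)).toLinearMap)
  tr_comm f g := LinearMap.trace_comp_comm' f.hom.hom g.hom.hom
  existsUnique {X Y} φ := by
    let β : (Y →ₗ[ℂ] X) →ₗ[ℂ] Module.Dual ℂ (X →ₗ[ℂ] Y) :=
      (LinearMap.llcomp ℂ X Y X).compr₂ (LinearMap.trace ℂ X)
    have β_injective : Function.Injective β := by
      rw [injective_iff_map_eq_zero]
      exact fun g hg => LinearMap.eq_zero_of_trace_comp_eq_zero fun f => DFunLike.congr_fun hg f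
    have β_surjective : Function.Surjective β :=
      (LinearMap.injective_iff_surjective_of_finrank_eq_finrank (by
        rw [Subspace.dual_finrank_eq, Module.finrank_linearMap, Module.finrank_linearMap,
          mul_comm])).1 β_injective
    let φ' : Module.Dual ℂ (X →ₗ[ℂ] Y) := φ.comp
      ((InducedCategory.homLinearEquiv (R := ℂ)).symm.toLinearMap.comp
        (ModuleCat.homLinearEquiv (S := ℂ)).symm.toLinearMap)
    obtain ⟨g, hg⟩ := β_surjective φ'
    refine ⟨FGModuleCat.ofHom g, fun f => DFunLike.congr_fun hg f.hom.hom, fun g' hg' => ?_⟩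
    ext : 1
    refine β_injective (LinearMap.ext fun f => ?_)
    exact (hg' (FGModuleCat.ofHom f)).trans (DFunLike.congr_fun hg f).symm

end Trace

section RightAdjoint

namespace FGModuleCat

/-- The one-dimensional space, lifted to an arbitrary universe. -/
abbrev line : FGModuleCat.{v} ℂ := of ℂ (ULift.{v} ℂ)

/-- The morphism from the one-dimensional space which picks out a vector. -/
noncomputable def point (V : FGModuleCat.{v} ℂ) : V →ₗ[ℂ] (line.{v} ⟶ V) where
  toFun x := ofHom ((LinearMap.toSpanSingleton ℂ V x).comp ULift.moduleEquiv.toLinearMap)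
  map_add' x y := by ext c; exact smul_add c.down x y
  map_smul' r x := by ext c; exact smul_comm c.down r x

lemma point_comp {V W : FGModuleCat.{v} ℂ} (x : V) (f : V ⟶ W) :
    V.point x ≫ f = W.point (f.hom.hom x) := by
  ext c
  exact f.hom.hom.map_smul c.down x

/-- The coordinate functions of a finite-dimensional space with respect to a fixed basis. -/
noncomputable def coordHom (V : FGModuleCat.{v} ℂ) (a : Fin (Module.finrank ℂ V)) :
    V ⟶ line.{v} :=
  ofHom (ULift.moduleEquiv.symm.toLinearMap.comp ((Module.finBasis ℂ V).coord a))

lemma point_comp_coordHom (V : FGModuleCat.{v} ℂ) (x : V) (a : Fin (Module.finrank ℂ V)) :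
    V.point x ≫ V.coordHom a = (Module.finBasis ℂ V).repr x a • 𝟙 line.{v} := by
  rw [point_comp]
  ext c
  exact mul_comm c.down ((Module.finBasis ℂ V).repr x a)

lemma sum_coordHom_comp_point (V : FGModuleCat.{v} ℂ) :
    ∑ a, V.coordHom a ≫ V.point (Module.finBasis ℂ V a) = 𝟙 V := by
  let e : (V ⟶ V) ≃ₗ[ℂ] (V →ₗ[ℂ] V) :=
    (InducedCategory.homLinearEquiv (R := ℂ)).trans (ModuleCat.homLinearEquiv (S := ℂ))
  apply e.injective
  rw [map_sum]
  ext x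
  rw [LinearMap.sum_apply]
  exact (Module.finBasis ℂ V).sum_repr x

lemma exists_linearEquiv (W : Type*) [AddCommGroup W] [Module ℂ W] [Module.Finite ℂ W] :
    ∃ V : FGModuleCat.{v} ℂ, Nonempty (V ≃ₗ[ℂ] W) :=
  ⟨of ℂ (ULift.{v} (Fin (Module.finrank ℂ W) → ℂ)),
    ⟨ULift.moduleEquiv.trans (Module.finBasis ℂ W).equivFun.symm⟩⟩

variable {I : Type*} [DecidableEq I]

/-- The morphism from the constant family at the one-dimensional space which picks out a vector
in the component `i`. -/
noncomputable def piPoint (X : I → FGModuleCat.{v} ℂ) (i : I) :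
    X i →ₗ[ℂ] ((fun _ => line : I → FGModuleCat.{v} ℂ) ⟶ X) :=
  (piSingleHom i).comp (X i).point

lemma piPoint_comp {X Y : I → FGModuleCat.{v} ℂ} (i : I) (x : X i) (f : X ⟶ Y) :
    piPoint X i x ≫ f = piPoint Y i ((f i).hom.hom x) := by
  simp [piPoint, piSingleHom_comp, point_comp]

/-- The projection of the constant family at the one-dimensional space to the component `i`. -/
noncomputable def piProj (i : I) :
    (fun _ => line : I → FGModuleCat.{v} ℂ) ⟶ (fun _ => line) :=
  piSingleHom i (𝟙 line)

lemma piProj_comp_piPoint (X : I → FGModuleCat.{v} ℂ) (i : I) (x : X i) :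
    piProj i ≫ piPoint X i x = piPoint X i x := by
  simp [piPoint, piProj, piSingleHom_comp]

/-- The coordinate functions of the component `i` of a family of finite-dimensional spaces. -/
noncomputable def piCoordHom (X : I → FGModuleCat.{v} ℂ) (i : I)
    (a : Fin (Module.finrank ℂ (X i))) : X ⟶ (fun _ => line) :=
  piSingleHom i ((X i).coordHom a)

lemma sum_piCoordHom_comp_piPoint [Fintype I] (X : I → FGModuleCat.{v} ℂ) :
    ∑ i, ∑ a, piCoordHom X i a ≫ piPoint X i (Module.finBasis ℂ (X i) a) = 𝟙 X := by
  simp only [piCoordHom, piPoint, piSingleHom_comp, LinearMap.comp_apply, piSingleHom_same,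
    ← map_sum, sum_coordHom_comp_point]
  exact sum_piSingleHom (𝟙 X)

lemma piPoint_comp_piCoordHom (X : I → FGModuleCat.{v} ℂ) (i : I) (x : X i)
    (a : Fin (Module.finrank ℂ (X i))) :
    piPoint X i x ≫ piCoordHom X i a = (Module.finBasis ℂ (X i)).repr x a • piProj i := by
  simp [piPoint, piCoordHom, piSingleHom_comp, point_comp_coordHom, piProj]

lemma piPoint_comp_piCoordHom_of_ne (X : I → FGModuleCat.{v} ℂ) {i j : I} (h : i ≠ j) (x : X i)
    (a : Fin (Module.finrank ℂ (X j))) : piPoint X i x ≫ piCoordHom X j a = 0 :=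
  piSingleHom_comp_piSingleHom_of_ne h _ _

variable [Fintype I] {D : Type*} [Category D] [Preadditive D] [Linear ℂ D]

/-- A linear functor from a finite power of the category of finite-dimensional vector spaces to
a linear category with finite-dimensional hom-spaces has a right adjoint. -/
theorem exists_rightAdjoint (hD : ∀ X Y : D, Module.Finite ℂ (X ⟶ Y))
    (F : (I → FGModuleCat.{v} ℂ) ⥤ D) [F.Additive] [F.Linear ℂ] :
    ∃ G : D ⥤ (I → FGModuleCat.{v} ℂ), Nonempty (F ⊣ G) := by
  let U : I → FGModuleCat.{v} ℂ := fun _ => line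
  let W (Y : D) (i : I) : Submodule ℂ (F.obj U ⟶ Y) :=
    LinearMap.ker (Linear.leftComp ℂ Y (F.map (piProj i)) - LinearMap.id)
  have mem_W {Y : D} {i : I} {h : F.obj U ⟶ Y} : h ∈ W Y i ↔ F.map (piProj i) ≫ h = h := by
    simp [W, sub_eq_zero]
  have W_finite (Y : D) (i : I) : Module.Finite ℂ (W Y i) := by
    have := hD (F.obj U) Y
    infer_instance
  choose G ψ using fun Y i => FGModuleCat.exists_linearEquiv.{v} (W Y i)
  replace ψ := fun Y i => (ψ Y i).some
  let restrict (X : I → FGModuleCat.{v} ℂ) (Y : D) (f : F.obj X ⟶ Y) (i : I) :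
      X i →ₗ[ℂ] W Y i :=
    LinearMap.codRestrict (W Y i)
      ((Linear.rightComp ℂ (F.obj U) f).comp ((F.mapLinearMap ℂ).comp (piPoint X i)))
      fun x => mem_W.2 (by
        change F.map (piProj i) ≫ F.map (piPoint X i x) ≫ f = F.map (piPoint X i x) ≫ f
        rw [← Functor.map_comp_assoc, piProj_comp_piPoint])
  let Φ (X : I → FGModuleCat.{v} ℂ) (Y : D) (f : F.obj X ⟶ Y) : X ⟶ G Y :=
    fun i => FGModuleCat.ofHom ((ψ Y i).symm.toLinearMap.comp (restrict X Y f i))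
  have Φ_spec (X : I → FGModuleCat.{v} ℂ) (Y : D) (f : F.obj X ⟶ Y) (i : I) (x : X i) :
      (ψ Y i ((Φ X Y f i).hom.hom x) : F.obj U ⟶ Y) = F.map (piPoint X i x) ≫ f :=
    congrArg Subtype.val ((ψ Y i).apply_symm_apply (restrict X Y f i x))
  have hom_ext (X : I → FGModuleCat.{v} ℂ) (Y : D) {g g' : X ⟶ G Y}
      (h : ∀ i x, (ψ Y i ((g i).hom.hom x) : F.obj U ⟶ Y) = ψ Y i ((g' i).hom.hom x)) :
      g = g' := by
    funext i
    ext x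
    exact (ψ Y i).injective (Subtype.ext (h i x))
  have resolution (X : I → FGModuleCat.{v} ℂ) (Y : D) (f : F.obj X ⟶ Y) :
      ∑ i, ∑ a, F.map (piCoordHom X i a) ≫ F.map (piPoint X i (Module.finBasis ℂ (X i) a)) ≫ f =
        f := by
    simp only [← Functor.map_comp_assoc, ← Preadditive.sum_comp, ← Functor.map_sum,
      sum_piCoordHom_comp_piPoint]
    exact (congrArg (· ≫ f) (F.map_id X)).trans (Category.id_comp f)
  have Φ_bijective (X : I → FGModuleCat.{v} ℂ) (Y : D) : Function.Bijective (Φ X Y) := by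
    refine ⟨fun f f' h => ?_, fun g => ⟨∑ j, ∑ a, F.map (piCoordHom X j a) ≫
      (ψ Y j ((g j).hom.hom (Module.finBasis ℂ (X j) a)) : F.obj U ⟶ Y),
      hom_ext X Y fun i x => ?_⟩⟩
    · rw [← resolution X Y f, ← resolution X Y f']
      simp only [← Φ_spec, h]
    · rw [Φ_spec, Preadditive.comp_sum, Finset.sum_eq_single i]
      · simp only [Preadditive.comp_sum, ← Functor.map_comp_assoc, piPoint_comp_piCoordHom,
          Functor.map_smul, Linear.smul_comp, mem_W.1 (Subtype.property _)]
        rw [show (g i).hom.hom x = ∑ a, (Module.finBasis ℂ (X i)).repr x a •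
            (g i).hom.hom (Module.finBasis ℂ (X i) a) by
          simp only [← map_smul, ← map_sum, Module.Basis.sum_repr]]
        simp
      · intro j _ hj
        simp [Preadditive.comp_sum, ← Functor.map_comp_assoc,
          piPoint_comp_piCoordHom_of_ne X hj.symm]
      · simp
  exact ⟨_, ⟨Adjunction.adjunctionOfEquivRight
    (fun X Y => Equiv.ofBijective (Φ X Y) (Φ_bijective X Y))
    fun X' X Y u f => hom_ext X' Y fun i x => by
      change (ψ Y i ((Φ X' Y (F.map u ≫ f) i).hom.hom x) : F.obj U ⟶ Y) =
        ψ Y i ((Φ X Y f i).hom.hom ((u i).hom.hom x))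
      rw [Φ_spec, Φ_spec, ← piPoint_comp, Functor.map_comp_assoc]⟩⟩

end FGModuleCat

end RightAdjoint

/-- Every additive ℂ-linear functor between the 2-vector spaces `Vect^n` and `Vect^m`
admits an ambidextrous adjoint: a functor `G` which is simultaneously a left adjoint
and a right adjoint of `F`. -/
theorem two_linear_map_has_ambidextrous_adjoint {n m : ℕ}
    (F : (Fin n → FGModuleCat ℂ) ⥤ (Fin m → FGModuleCat ℂ))
    [F.Additive] [F.Linear ℂ] :
    ∃ G : (Fin m → FGModuleCat ℂ) ⥤ (Fin n → FGModuleCat ℂ),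
      Nonempty (G ⊣ F) ∧ Nonempty (F ⊣ G) := by
  obtain ⟨G, ⟨adj⟩⟩ := FGModuleCat.exists_rightAdjoint (fun X Y =>
    inferInstanceAs (Module.Finite ℂ (∀ i, X i ⟶ Y i))) F
  exact ⟨G, PerfectTrace.nonempty_adjunction_of_adjunction
    (PerfectTrace.pi fun _ => fgModuleCatPerfectTrace)
    (PerfectTrace.pi fun _ => fgModuleCatPerfectTrace) adj, ⟨adj⟩⟩
end

section
/- Let X be a finite groupoid. Then every object F of the functor category X ⥤ FGModuleCat ℂ is semisimple: there exist k : ℕ and a family S : Fin k → (X ⥤ FGModuleCat ℂ) such that each S i is a simple object of the functor category and F is isomorphic to the biproduct ⨁ i, S i. -/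
open CategoryTheory CategoryTheory.Limits

noncomputable instance : HasFiniteBiproducts (FGModuleCat ℂ) :=
  HasFiniteBiproducts.of_hasFiniteProducts

noncomputable instance (X : Type) [Category X] :
    HasFiniteBiproducts (X ⥤ FGModuleCat ℂ) :=
  HasFiniteBiproducts.of_hasFiniteProducts

open Module

universe v u

section Biproducts

variable {C : Type*} [Category* C] [Preadditive C] [HasFiniteBiproducts C]

/-- An object which is isomorphic to a finite biproduct of simple objects. -/
def IsFiniteBiproductOfSimples (F : C) : Prop :=
  ∃ (k : ℕ) (S : Fin k → C), (∀ i, Simple (S i)) ∧ Nonempty (F ≅ ⨁ S)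

namespace IsFiniteBiproductOfSimples

lemma of_isZero {F : C} (hF : IsZero F) : IsFiniteBiproductOfSimples F := by
  refine ⟨0, Fin.elim0, fun i => i.elim0, ⟨hF.iso ?_⟩⟩
  rw [IsZero.iff_id_eq_zero]
  ext i
  exact i.elim0

lemma of_simple (F : C) [hF : Simple F] : IsFiniteBiproductOfSimples F :=
  ⟨1, fun _ => F, fun _ => hF, ⟨(biproductUniqueIso fun _ : Fin 1 => F).symm⟩⟩

lemma of_iso {F G : C} (e : F ≅ G) (hG : IsFiniteBiproductOfSimples G) :
    IsFiniteBiproductOfSimples F := by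
  obtain ⟨k, S, hS, ⟨i⟩⟩ := hG
  exact ⟨k, S, hS, ⟨e ≪≫ i⟩⟩

end IsFiniteBiproductOfSimples

variable [HasBinaryBiproducts C]

/-- The biproduct of a family indexed by a disjoint union is the binary biproduct of the
biproducts of the two subfamilies. -/
noncomputable def biprodBiproductIso {ι κ : Type} [Finite ι] [Finite κ] (S : ι ⊕ κ → C) :
    (⨁ fun i => S (.inl i)) ⊞ (⨁ fun j => S (.inr j)) ≅ ⨁ S where
  hom := biprod.desc (biproduct.desc fun i => biproduct.ι S (.inl i))
    (biproduct.desc fun j => biproduct.ι S (.inr j))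
  inv := biproduct.desc fun
    | .inl i => biproduct.ι (fun i => S (.inl i)) i ≫ biprod.inl
    | .inr j => biproduct.ι (fun j => S (.inr j)) j ≫ biprod.inr
  hom_inv_id := by
    apply biprod.hom_ext' <;> apply biproduct.hom_ext' <;> intro i <;> simp
  inv_hom_id := by
    apply biproduct.hom_ext'
    rintro (i | j) <;> simp

lemma IsFiniteBiproductOfSimples.biprod {F G : C} (hF : IsFiniteBiproductOfSimples F)
    (hG : IsFiniteBiproductOfSimples G) : IsFiniteBiproductOfSimples (F ⊞ G) := by
  obtain ⟨k, S, hS, ⟨i⟩⟩ := hF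
  obtain ⟨l, T, hT, ⟨j⟩⟩ := hG
  refine ⟨k + l, Sum.elim S T ∘ finSumFinEquiv.symm, fun a => ?_,
    ⟨biprod.mapIso i j ≪≫ biprodBiproductIso (Sum.elim S T) ≪≫
      (biproduct.reindex finSumFinEquiv.symm (Sum.elim S T)).symm⟩⟩
  rcases h : finSumFinEquiv.symm a with b | b
  · simpa [h] using hS b
  · simpa [h] using hT b

end Biproducts

/-- If every monomorphism splits and some natural number valued invariant strictly decreases
along proper subobjects, then every object is a finite biproduct of simple objects. -/
theorem isFiniteBiproductOfSimples_of_isSplitMono {C : Type*} [Category* C] [Abelian C]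
    [HasFiniteBiproducts C]
    (split : ∀ {G F : C} (f : G ⟶ F) [Mono f], IsSplitMono f) (d : C → ℕ)
    (d_lt : ∀ {G F : C} (f : G ⟶ F) [Mono f], ¬ IsIso f → d G < d F) (F : C) :
    IsFiniteBiproductOfSimples F := by
  induction hn : d F using Nat.strong_induction_on generalizing F with
  | _ n ih =>
  subst hn
  by_cases hF : IsZero F
  · exact .of_isZero hF
  by_cases hs : Simple F
  · exact .of_simple F
  obtain ⟨G, f, hf, hiso, hne⟩ : ∃ (G : C) (f : G ⟶ F), Mono f ∧ ¬ IsIso f ∧ f ≠ 0 := by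
    by_contra! h
    refine hs ⟨fun {G} f _ => ⟨?_, fun hne => ?_⟩⟩
    · rintro _ rfl
      exact hF (IsZero.of_epi_eq_zero (0 : G ⟶ F) rfl)
    · by_contra hiso
      exact hne (h G f ‹_› hiso)
  have := split f
  have hker : ¬ IsIso (kernel.ι (retraction f)) := fun _ => by
    have h0 : retraction f = 0 := by
      rw [← cancel_epi (kernel.ι (retraction f)), kernel.condition, comp_zero]
    have h1 : 𝟙 G = 0 := by rw [← IsSplitMono.id f, h0, comp_zero]
    exact hne (by rw [← Category.id_comp f, h1, zero_comp])
  have e : F ≅ kernel (retraction f) ⊞ G :=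
    biprod.uniqueUpToIso _ _
      (isBilimitBinaryBiconeOfIsSplitEpiOfKernel (kernelIsKernel (retraction f)))
  exact .of_iso e ((ih _ (d_lt _ hker) _ rfl).biprod (ih _ (d_lt f hiso) _ rfl))

namespace FGModuleCat

variable {K : Type u} [Field K]

lemma injective_of_mono {V W : FGModuleCat.{v} K} (f : V ⟶ W) [Mono f] :
    Function.Injective f.hom.hom :=
  (ModuleCat.mono_iff_injective _).1
    (inferInstanceAs (Mono ((forget₂ (FGModuleCat K) (ModuleCat K)).map f)))

lemma isSplitMono_of_mono {V W : FGModuleCat.{v} K} (f : V ⟶ W) [Mono f] : IsSplitMono f := by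
  obtain ⟨g, hg⟩ := f.hom.hom.exists_leftInverse_of_injective
    (LinearMap.ker_eq_bot.2 (injective_of_mono f))
  exact ⟨⟨⟨ofHom g, by ext : 1; exact hg⟩⟩⟩

lemma finrank_le_of_mono {V W : FGModuleCat.{v} K} (f : V ⟶ W) [Mono f] :
    finrank K V ≤ finrank K W :=
  LinearMap.finrank_le_finrank_of_injective (injective_of_mono f)

lemma isIso_of_mono_of_finrank_eq {V W : FGModuleCat.{v} K} (f : V ⟶ W) [Mono f]
    (h : finrank K V = finrank K W) : IsIso f :=
  (LinearEquiv.toFGModuleCatIso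
    (LinearEquiv.ofInjectiveOfFinrankEq f.hom.hom (injective_of_mono f) h)).isIso_hom

end FGModuleCat

section Groupoid

variable {X : Type} [Groupoid X] [FinCategory X]

/-- Maschke's theorem for functors out of a finite groupoid: a natural transformation which is
pointwise a split monomorphism is a split monomorphism, by averaging the pointwise retractions. -/
theorem isSplitMono_of_isSplitMono_app {K : Type*} [Field K] [CharZero K] {C : Type*} [Category* C]
    [Preadditive C] [Linear K C] {G F : X ⥤ C} (f : G ⟶ F) (hf : ∀ x, IsSplitMono (f.app x)) :
    IsSplitMono f := by
  let avg (x : X) : F.obj x ⟶ G.obj x := ((Fintype.card (Σ y, x ⟶ y) : K)⁻¹) •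
    ∑ p : Σ y, x ⟶ y, F.map p.2 ≫ retraction (f.app p.1) ≫ G.map (Groupoid.inv p.2)
  have shift {x x' : X} (g : x ⟶ x') : ∃ e : (Σ y, x' ⟶ y) ≃ (Σ y, x ⟶ y),
      ∀ p, e p = ⟨p.1, g ≫ p.2⟩ :=
    ⟨{ toFun := fun p => ⟨p.1, g ≫ p.2⟩
       invFun := fun p => ⟨p.1, Groupoid.inv g ≫ p.2⟩
       left_inv := fun p => by simp
       right_inv := fun p => by simp }, fun _ => rfl⟩
  refine ⟨⟨⟨{ app := avg, naturality := fun x x' g => ?_ }, ?_⟩⟩⟩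
  · obtain ⟨e, he⟩ := shift g
    simp only [avg, Linear.comp_smul, Linear.smul_comp, Preadditive.comp_sum,
      Preadditive.sum_comp, Fintype.card_congr e]
    congr 1
    rw [← e.sum_comp]
    refine Finset.sum_congr rfl fun p _ => ?_
    rw [he]
    simp [F.map_comp]
  · ext x
    have : Nonempty (Σ y, x ⟶ y) := ⟨⟨x, 𝟙 x⟩⟩
    have hterm (p : Σ y, x ⟶ y) : f.app x ≫ F.map p.2 ≫ retraction (f.app p.1) ≫
        G.map (Groupoid.inv p.2) = 𝟙 (G.obj x) := by
      rw [← f.naturality_assoc, IsSplitMono.id_assoc, ← G.map_comp, Groupoid.comp_inv, G.map_id]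
    simp only [avg, NatTrans.comp_app, NatTrans.id_app, Linear.comp_smul, Preadditive.comp_sum,
      hterm, Finset.sum_const, Finset.card_univ]
    rw [← Nat.cast_smul_eq_nsmul K, smul_smul,
      inv_mul_cancel₀ (Nat.cast_ne_zero.2 Fintype.card_ne_zero), one_smul]

lemma sum_finrank_lt_of_mono {K : Type u} [Field K] {G F : X ⥤ FGModuleCat.{v} K} (f : G ⟶ F)
    [Mono f] (hf : ¬ IsIso f) :
    ∑ x, finrank K (G.obj x) < ∑ x, finrank K (F.obj x) := by
  refine lt_of_le_of_ne
    (Finset.sum_le_sum fun x _ => FGModuleCat.finrank_le_of_mono (f.app x)) fun h => hf ?_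
  rw [Finset.sum_eq_sum_iff_of_le fun x _ => FGModuleCat.finrank_le_of_mono (f.app x)] at h
  have (x : X) : IsIso (f.app x) :=
    FGModuleCat.isIso_of_mono_of_finrank_eq _ (h x (Finset.mem_univ x))
  exact NatIso.isIso_of_isIso_app f

end Groupoid

/-- The category of `Vect`-valued presheaves on a finite groupoid is semisimple:
every object is a finite biproduct of simple objects.  (This is the key property
making `X ⥤ FGModuleCat ℂ` a Kapranov–Voevodsky 2-vector space.) -/
theorem functor_category_semisimple (X : Type) [Groupoid X] [FinCategory X]
    (F : X ⥤ FGModuleCat ℂ) :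
    ∃ (k : ℕ) (S : Fin k → (X ⥤ FGModuleCat ℂ)),
      (∀ i, Simple (S i)) ∧ Nonempty (F ≅ ⨁ S) := by
  exact isFiniteBiproductOfSimples_of_isSplitMono
    (fun f _ => isSplitMono_of_isSplitMono_app (K := ℂ) f
      fun x => FGModuleCat.isSplitMono_of_mono (f.app x))
    (fun F => ∑ x, finrank ℂ (F.obj x)) (fun f _ => sum_finrank_lt_of_mono f) F
end

section
/- Let X be a finite groupoid. Then the functor category X ⥤ FGModuleCat ℂ is equivalent to the product, over the skeleton of X, of the categories of finite-dimensional representations of the automorphism groups: (X ⥤ FGModuleCat ℂ) ≌ ∀ x : Skeleton X, FDRep ℂ (Aut x). -/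
open CategoryTheory CategoryTheory.Limits

section SkeletalGroupoid

universe v₁ v₂ u₁ u₂

variable {D : Type u₁} [Category.{v₁} D] {V : Type u₂} [Category.{v₂} V]

/-- The action of the automorphism group of `x` on the value at `x` of a functor `F`. -/
def CategoryTheory.Functor.autAction (F : D ⥤ V) (x : D) : Action V (Aut x) where
  V := F.obj x
  ρ :=
    { toFun := fun g => F.map g.hom
      map_one' := F.map_id x
      map_mul' := fun g h => F.map_comp h.hom g.hom }

variable (D V) in
/-- The functor sending `F : D ⥤ V` to the family of actions of the groups `Aut x` on the
objects `F.obj x`. -/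
def functorToPiAction : (D ⥤ V) ⥤ ∀ x : D, Action V (Aut x) where
  obj F x := F.autAction x
  map α x :=
    { hom := α.app x
      comm := fun g => α.naturality g.hom }

instance : (functorToPiAction D V).Faithful where
  map_injective {F G α β} h := by
    ext x
    exact congrArg Action.Hom.hom (congrFun h x)

variable [IsGroupoid D]

/-- Morphisms of a skeletal groupoid only exist between equal objects. -/
theorem CategoryTheory.Skeletal.eq_of_hom (hD : Skeletal D) {x y : D} (f : x ⟶ y) : x = y :=
  hD ⟨asIso f⟩

theorem functorToPiAction_full (hD : Skeletal D) : (functorToPiAction D V).Full where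
  map_surjective {F G} β := by
    refine ⟨{ app := fun x => (β x).hom, naturality := fun x y f => ?_ }, rfl⟩
    obtain rfl := hD.eq_of_hom f
    exact (β x).comm (asIso f)

/-- Over a skeletal groupoid, a family of actions of the automorphism groups assembles into a
functor. -/
noncomputable def functorOfPiAction (hD : Skeletal D) (A : ∀ x : D, Action V (Aut x)) :
    D ⥤ V where
  obj x := (A x).V
  map {x y} f := (A x).ρ (asIso (f ≫ eqToHom (hD.eq_of_hom f).symm)) ≫
    eqToHom (congrArg (fun z => (A z).V) (hD.eq_of_hom f))
  map_id x := by
    have h : asIso (𝟙 x ≫ eqToHom rfl) = (1 : Aut x) := by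
      ext
      exact Category.comp_id _
    rw [h, map_one]
    exact Category.comp_id _
  map_comp {x y z} f g := by
    obtain rfl := hD.eq_of_hom f
    obtain rfl := hD.eq_of_hom g
    have h : asIso ((f ≫ g) ≫ eqToHom rfl) =
        (show Aut x from asIso (g ≫ eqToHom rfl)) * (show Aut x from asIso (f ≫ eqToHom rfl)) := by
      ext
      change (f ≫ g) ≫ 𝟙 x = (f ≫ 𝟙 x) ≫ g ≫ 𝟙 x
      simp
    rw [h, map_mul]
    simp [End.mul_def]

theorem functorOfPiAction_map_self (hD : Skeletal D) (A : ∀ x : D, Action V (Aut x)) {x : D}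
    (g : Aut x) : (functorOfPiAction hD A).map g.hom = (A x).ρ g := by
  have h : asIso (g.hom ≫ eqToHom rfl) = g := by
    ext
    exact Category.comp_id _
  change (A x).ρ (asIso (g.hom ≫ eqToHom rfl)) ≫ 𝟙 _ = _
  rw [h]
  exact Category.comp_id _

theorem functorToPiAction_essSurj (hD : Skeletal D) : (functorToPiAction D V).EssSurj where
  mem_essImage A := ⟨functorOfPiAction hD A, ⟨Pi.isoMk fun _ =>
    Action.mkIso (Iso.refl _) fun g =>
      (Category.comp_id _).trans
        ((functorOfPiAction_map_self hD A g).trans (Category.id_comp _).symm)⟩⟩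

theorem functorToPiAction_isEquivalence (hD : Skeletal D) :
    (functorToPiAction D V).IsEquivalence where
  full := functorToPiAction_full hD
  essSurj := functorToPiAction_essSurj hD

end SkeletalGroupoid

/-- Finitely generated modules over a small ring form the same category, up to equivalence, in
every universe. -/
noncomputable def FGModuleCat.equivalenceOfSmallRing.{w} (R : Type) [CommRing R] :
    FGModuleCat.{w} R ≌ FGModuleCat.{0} R :=
  (FGModuleCat.ulift.{0, w} R).asEquivalence.symm

/-- The 2-vector space of `Vect`-valued presheaves on a finite groupoid `X` is
equivalent to the product, over the skeleton of `X`, of the categories of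
finite-dimensional representations of the automorphism groups. -/
theorem functor_category_equiv_pi_fdRep (X : Type) [Groupoid X] [FinCategory X] :
    Nonempty ((X ⥤ FGModuleCat ℂ) ≌ ∀ x : Skeleton X, FDRep ℂ (Aut x)) := by
  have : IsGroupoid (Skeleton X) :=
    ⟨fun f => isIso_of_reflects_iso f (fromSkeleton X)⟩
  have := functorToPiAction_isEquivalence (V := FGModuleCat.{0} ℂ) (skeleton_skeletal X)
  exact ⟨((skeletonEquivalence X).symm.congrLeft.trans
    (FGModuleCat.equivalenceOfSmallRing ℂ).congrRight).trans
    (functorToPiAction (Skeleton X) (FGModuleCat.{0} ℂ)).asEquivalence⟩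
end

section
/- Let X be a finite groupoid and let c denote the constant functor X ⥤ FGModuleCat ℂ with value the one-dimensional space ℂ. Then the ℂ-vector space of natural endomorphisms of c has dimension equal to the number of isomorphism classes of objects of X: finrank ℂ (c ⟶ c) = Fintype.card (Skeleton X). -/
open CategoryTheory CategoryTheory.Limits

noncomputable instance (X : Type) [Groupoid X] [FinCategory X] :
    Fintype (Skeleton X) :=
  have : Finite (Skeleton X) := Quotient.finite _
  Fintype.ofFinite _

universe w v₁ u₁ v₂ u₂

/-- In a groupoid, a natural transformation between constant functors takes the same value on
isomorphic objects, so it amounts to a family of morphisms indexed by the skeleton. -/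
noncomputable def constHomLinearEquiv (R : Type w) [Semiring R] (X : Type u₁) [Groupoid.{v₁} X]
    {D : Type u₂} [Category.{v₂} D] [Preadditive D] [Linear R D] (A B : D) :
    ((Functor.const X).obj A ⟶ (Functor.const X).obj B) ≃ₗ[R] (Skeleton X → (A ⟶ B)) where
  toFun α s := α.app ((fromSkeleton X).obj s)
  map_add' _ _ := rfl
  map_smul' _ _ := rfl
  invFun f :=
    { app := fun x => f (toSkeleton x)
      naturality := fun x y g => by
        have h : toSkeleton x = toSkeleton y := Quotient.sound ⟨asIso g⟩
        simp [h] }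
  left_inv α := by
    ext x
    simpa using (α.naturality (fromSkeletonToSkeletonIso x).hom).symm
  right_inv f := by
    funext s
    exact congrArg f (Quotient.out_eq s)

/-- Morphisms in `FGModuleCat R` are linear maps. -/
def FGModuleCat.homLinearEquiv {R : Type u₁} [CommRing R] (V W : FGModuleCat.{v₁} R) :
    (V ⟶ W) ≃ₗ[R] (V →ₗ[R] W) :=
  InducedCategory.homLinearEquiv.trans ModuleCat.homLinearEquiv

/-- For a finite groupoid `X`, the space of natural endomorphisms of the constant
functor at `ℂ` has dimension the number of isomorphism classes of objects of `X`:
2-linearization over the terminal groupoid reproduces the free vector space on the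
set of isomorphism classes (degroupoidification). -/
theorem finrank_end_constant_functor (X : Type) [Groupoid X] [FinCategory X] :
    Module.finrank ℂ
        ((Functor.const X).obj (FGModuleCat.of ℂ ℂ) ⟶
          (Functor.const X).obj (FGModuleCat.of ℂ ℂ)) =
      Fintype.card (Skeleton X) := by
  have h : Module.finrank ℂ (FGModuleCat.of ℂ ℂ ⟶ FGModuleCat.of ℂ ℂ) = 1 :=
    (FGModuleCat.homLinearEquiv _ _).finrank_eq.trans
      ((Module.finrank_linearMap ℂ ℂ ℂ ℂ).trans (by simp))
  rw [(constHomLinearEquiv ℂ X _ _).finrank_eq, Module.finrank_pi_fintype]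
  simp [h]
end

section
/- Let X be a finite groupoid. A functor F : X ⥤ FGModuleCat ℂ is a simple object of the functor category X ⥤ FGModuleCat ℂ if and only if there exists an object x₀ of X such that: (i) F.obj y is the zero object for every y not isomorphic to x₀; (ii) F.obj x₀ is nonzero; and (iii) the representation of the automorphism group Aut x₀ on the vector space underlying F.obj x₀, in which g : Aut x₀ acts by the linear map underlying F.map g.hom, is irreducible, i.e. the only ℂ-subspaces of F.obj x₀ invariant under all these actions are the zero subspace and the whole space. -/
open CategoryTheory CategoryTheory.Limits

namespace FGModuleCat

lemma isZero_iff_subsingleton {k : Type*} [Ring k] (V : FGModuleCat k) :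
    IsZero V ↔ Subsingleton V := by
  rw [IsZero.iff_id_eq_zero]
  refine ⟨fun h ↦ ⟨fun v w ↦ ?_⟩, fun _ ↦ ?_⟩
  · have h' (u : V) : u = 0 := congr($(h).hom.hom u)
    rw [h' v, h' w]
  · ext v
    exact Subsingleton.elim (α := V) _ _

end FGModuleCat

namespace CategoryTheory.Functor

variable {C : Type*} [Category* C] {k : Type*} [Ring k] (F : C ⥤ FGModuleCat k)

/-- The largest family of submodules stable under the maps of `F` contained in `q`
at `x`. -/
def submodulesOver {x : C} (q : Submodule k (F.obj x)) (y : C) : Submodule k (F.obj y) :=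
  ⨅ f : y ⟶ x, q.comap (F.map f).hom.hom

variable {F} in
lemma mem_submodulesOver {x : C} {q : Submodule k (F.obj x)} {y : C} {v : F.obj y} :
    v ∈ F.submodulesOver q y ↔ ∀ f : y ⟶ x, F.map f v ∈ q :=
  Submodule.mem_iInf _

lemma submodulesOver_self_le {x : C} (q : Submodule k (F.obj x)) : F.submodulesOver q x ≤ q := by
  intro v hv
  simpa using mem_submodulesOver.1 hv (𝟙 x)

variable [IsNoetherianRing k]

/-- The subfunctor given by a family of submodules stable under the maps of `F`. -/
noncomputable def ofSubmodules (p : ∀ y, Submodule k (F.obj y))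
    (hp : ∀ {y z : C} (g : y ⟶ z), ∀ v ∈ p y, F.map g v ∈ p z) : C ⥤ FGModuleCat k where
  obj y := FGModuleCat.of k (p y)
  map g := FGModuleCat.ofHom ((F.map g).hom.hom.restrict (hp g))
  map_id y := by
    ext v
    exact congr($(F.map_id y).hom.hom v.1)
  map_comp f g := by
    ext v
    exact congr($(F.map_comp f g).hom.hom v.1)

/-- The inclusion of the subfunctor given by a stable family of submodules. -/
noncomputable def ofSubmodulesι (p : ∀ y, Submodule k (F.obj y))
    (hp : ∀ {y z : C} (g : y ⟶ z), ∀ v ∈ p y, F.map g v ∈ p z) :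
    F.ofSubmodules p hp ⟶ F where
  app y := FGModuleCat.ofHom (p y).subtype
  naturality _ _ _ := rfl

instance mono_ofSubmodulesι (p : ∀ y, Submodule k (F.obj y))
    (hp : ∀ {y z : C} (g : y ⟶ z), ∀ v ∈ p y, F.map g v ∈ p z) :
    Mono (F.ofSubmodulesι p hp) := by
  have (y : C) : Mono ((F.ofSubmodulesι p hp).app y) :=
    ConcreteCategory.mono_of_injective _ (p y).injective_subtype
  exact NatTrans.mono_of_mono_app _

lemma eq_bot_or_eq_top_of_simple [Simple F] (p : ∀ y, Submodule k (F.obj y))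
    (hp : ∀ {y z : C} (g : y ⟶ z), ∀ v ∈ p y, F.map g v ∈ p z) :
    (∀ y, p y = ⊥) ∨ (∀ y, p y = ⊤) := by
  by_cases h : F.ofSubmodulesι p hp = 0
  · refine .inl fun y ↦ (Submodule.eq_bot_iff _).2 fun v hv ↦ ?_
    exact congr(($(h).app y).hom.hom ⟨v, hv⟩)
  · have := isIso_of_mono_of_nonzero h
    refine .inr fun y ↦ Submodule.eq_top_iff'.2 fun v ↦ ?_
    let i := asIso (F.ofSubmodulesι p hp)
    have hv : (i.inv.app y ≫ i.hom.app y).hom.hom v = v := by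
      rw [i.inv_hom_id_app]
      rfl
    rw [← hv]
    exact ((i.inv.app y).hom.hom v).2

lemma submodulesOver_eq_bot_or_eq_top [Simple F] {x : C} (q : Submodule k (F.obj x)) :
    (∀ y, F.submodulesOver q y = ⊥) ∨ (∀ y, F.submodulesOver q y = ⊤) := by
  refine F.eq_bot_or_eq_top_of_simple _ fun g v hv ↦ mem_submodulesOver.2 fun f ↦ ?_
  have := mem_submodulesOver.1 hv (g ≫ f)
  rwa [F.map_comp, ConcreteCategory.comp_apply] at this

lemma isZero_obj_of_simple [Simple F] {x y : C} (hx : ¬ IsZero (F.obj x))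
    (hy : IsEmpty (y ⟶ x)) : IsZero (F.obj y) := by
  have htop : F.submodulesOver (⊥ : Submodule k (F.obj x)) y = ⊤ := iInf_of_empty _
  rw [FGModuleCat.isZero_iff_subsingleton] at hx ⊢
  rcases F.submodulesOver_eq_bot_or_eq_top (⊥ : Submodule k (F.obj x)) with h | h
  · exact (Submodule.subsingleton_iff k).1 (subsingleton_of_bot_eq_top ((h y).symm.trans htop))
  · refine absurd ((Submodule.subsingleton_iff k).1 (subsingleton_of_bot_eq_top ?_)) hx
    exact (top_le_iff.1 ((h x).ge.trans (F.submodulesOver_self_le _)))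

lemma eq_bot_or_eq_top_of_simple_of_invariant [Simple F] {x : C} (q : Submodule k (F.obj x))
    (hq : ∀ (g : x ⟶ x) (v : F.obj x), v ∈ q → F.map g v ∈ q) : q = ⊥ ∨ q = ⊤ := by
  have hx : F.submodulesOver q x = q := (F.submodulesOver_self_le q).antisymm
    fun v hv ↦ mem_submodulesOver.2 fun g ↦ hq g v hv
  exact (F.submodulesOver_eq_bot_or_eq_top q).imp (fun h ↦ hx ▸ h x) (fun h ↦ hx ▸ h x)

lemma simple_of_isZero_of_irreducible {x : C}
    (hF : ∀ y, ¬ Nonempty (y ≅ x) → IsZero (F.obj y)) (hx : ¬ IsZero (F.obj x))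
    (hirr : ∀ p : Submodule k (F.obj x),
      (∀ (g : Aut x) (v : F.obj x), v ∈ p → F.map g.hom v ∈ p) → p = ⊥ ∨ p = ⊤) :
    Simple F where
  mono_isIso_iff_nonzero {Y} f _ := by
    constructor
    · rintro _ rfl
      refine hx ((IsZero.iff_id_eq_zero _).2 ?_)
      exact (IsIso.inv_hom_id ((0 : Y ⟶ F).app x)).symm.trans comp_zero
    intro hf
    have happ {y : C} (i : y ≅ x) : f.app y = Y.map i.hom ≫ f.app x ≫ F.map i.inv := by
      simp
    have hinv (g : Aut x) (v : F.obj x) (hv : v ∈ LinearMap.range (f.app x).hom.hom) :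
        F.map g.hom v ∈ LinearMap.range (f.app x).hom.hom := by
      obtain ⟨w, rfl⟩ := hv
      exact ⟨Y.map g.hom w, congr($(f.naturality g.hom).hom.hom w)⟩
    have : IsIso (f.app x) := by
      rcases hirr _ hinv with h | h
      · refine absurd ?_ hf
        have h0 : f.app x = 0 := FGModuleCat.hom_ext (LinearMap.range_eq_bot.1 h)
        ext1
        ext1 y
        by_cases hy : Nonempty (y ≅ x)
        · simp [happ hy.some, h0]
        · exact (hF y hy).eq_of_tgt _ _
      · have : Epi (f.app x) :=
          ConcreteCategory.epi_of_surjective _ (LinearMap.range_eq_top.1 h)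
        exact isIso_of_mono_of_epi _
    have (y : C) : IsIso (f.app y) := by
      by_cases hy : Nonempty (y ≅ x)
      · rw [happ hy.some]
        infer_instance
      · have : Epi (f.app y) := ⟨fun _ _ _ ↦ (hF y hy).eq_of_src _ _⟩
        exact isIso_of_mono_of_epi _
    exact NatIso.isIso_of_isIso_app f

end CategoryTheory.Functor

/-- Characterization of the simple objects of the 2-vector space of `Vect`-valued
presheaves on a finite groupoid `X`: a functor `F : X ⥤ FGModuleCat ℂ` is simple
iff it is supported on a single isomorphism class of objects, where it is a nonzero
irreducible representation of the automorphism group. -/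
theorem simple_functor_iff (X : Type) [Groupoid X] [FinCategory X]
    (F : X ⥤ FGModuleCat ℂ) :
    Simple F ↔
      ∃ x₀ : X,
        (∀ y : X, ¬ Nonempty (y ≅ x₀) → IsZero (F.obj y)) ∧
        ¬ IsZero (F.obj x₀) ∧
        (∀ p : Submodule ℂ (F.obj x₀),
          (∀ (g : Aut x₀) (v : F.obj x₀), v ∈ p → F.map g.hom v ∈ p) →
            p = ⊥ ∨ p = ⊤) := by
  constructor
  · intro _
    obtain ⟨x, hx⟩ : ∃ x, ¬ IsZero (F.obj x) := by
      by_contra! h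
      exact Simple.not_isZero F (Functor.isZero F h)
    refine ⟨x,
      fun y hy ↦ F.isZero_obj_of_simple hx ⟨fun f ↦ hy ⟨(Groupoid.isoEquivHom y x).symm f⟩⟩, hx,
      fun p hp ↦ F.eq_bot_or_eq_top_of_simple_of_invariant p fun g ↦ ?_⟩
    exact hp ((Groupoid.isoEquivHom x x).symm g)
  · rintro ⟨x, hF, hx, hirr⟩
    exact F.simple_of_isZero_of_irreducible hF hx hirr
end
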